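/- There exist finitely generated solvable groups G and H that are two-sided configuration equivalent but not isomorphic. -/

import Mathlib

/-- `g` is an ordered generating tuple of `G`. -/
def Generates {G : Type*} [Group G] {n : ℕ} (g : Fin n → G) : Prop :=
  Subgroup.closure (Set.range g) = ⊤

/-- The two-sided configuration set of the configuration pair `(g, c)`: a two-sided
configuration is a tuple `(c₀, (c₁, …, c_n), (c_{n+1}, …, c_{2n}))` of colors realized by
some `x ∈ G`, i.e. `c x = c₀`, `c (gᵢ * x) = cᵢ` and `c (x * gᵢ) = c_{n+i}` for all `i`. -/
def ConfigT {G : Type*} [Group G] {n m : ℕ} (g : Fin n → G) (c : G → Fin m) :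
    Set (Fin m × (Fin n → Fin m) × (Fin n → Fin m)) :=
  { p | ∃ x : G, c x = p.1 ∧ (∀ i, c (g i * x) = p.2.1 i) ∧ (∀ i, c (x * g i) = p.2.2 i) }

/-- Two-sided configuration equivalence of groups. -/
def ConfigTEquiv (G H : Type*) [Group G] [Group H] : Prop :=
  (∀ (n m : ℕ) (g : Fin n → G) (c : G → Fin m), Generates g →
    ∃ (h : Fin n → H) (d : H → Fin m), Generates h ∧ ConfigT g c = ConfigT h d) ∧
  (∀ (n m : ℕ) (h : Fin n → H) (d : H → Fin m), Generates h →
    ∃ (g : Fin n → G) (c : G → Fin m), Generates g ∧ ConfigT h d = ConfigT g c)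

section Lifting

variable {G H : Type*} [Group G] [Group H]

/-- Pulling a coloring back along a surjection does not change the configuration set. -/
theorem configT_comp_of_surjective {n m : ℕ} (π : H →* G) (hπ : Function.Surjective π)
    (h : Fin n → H) (c : G → Fin m) :
    ConfigT h (c ∘ π) = ConfigT (π ∘ h) c := by
  ext p
  simp only [ConfigT, Set.mem_ofPred_eq, Function.comp_apply, map_mul]
  exact ⟨fun ⟨x, hx⟩ => ⟨π x, hx⟩, fun ⟨y, hy⟩ => by
    obtain ⟨x, rfl⟩ := hπ y
    exact ⟨x, hy⟩⟩

open scoped commutatorElement in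
theorem commutatorElement_mul_center_left (l x : H) {z : H} (hz : z ∈ Subgroup.center H) :
    ⁅l * z, x⁆ = ⁅l, x⁆ := by
  have hzx : z * x = x * z := (Subgroup.mem_center_iff.1 hz x).symm
  simp only [commutatorElement_def, mul_inv_rev]
  calc l * z * x * (z⁻¹ * l⁻¹) * x⁻¹ = l * (z * x) * z⁻¹ * l⁻¹ * x⁻¹ := by group
    _ = l * x * l⁻¹ * x⁻¹ := by rw [hzx]; group

open scoped commutatorElement in
theorem commutatorElement_mul_center_right (l x : H) {z : H} (hz : z ∈ Subgroup.center H) :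
    ⁅x, l * z⁆ = ⁅x, l⁆ := by
  rw [← commutatorElement_inv, commutatorElement_mul_center_left l x hz, commutatorElement_inv]

/-- A central subgroup contained in the commutator subgroup consists of non-generators. -/
theorem eq_top_of_map_eq_top (π : H →* G)
    (hcen : π.ker ≤ Subgroup.center H) (hcom : π.ker ≤ commutator H)
    (L : Subgroup H) (hL : L.map π = ⊤) : L = ⊤ := by
  have key : ∀ x : H, ∃ l ∈ L, ∃ z ∈ π.ker, x = l * z := by
    intro x
    have hx : π x ∈ L.map π := hL ▸ Subgroup.mem_top _
    obtain ⟨l, hl, hlx⟩ := hx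
    exact ⟨l, hl, l⁻¹ * x, by simp [MonoidHom.mem_ker, hlx], by group⟩
  have hker : π.ker ≤ L := by
    refine hcom.trans (Subgroup.commutator_le.2 fun x _ y _ => ?_)
    obtain ⟨l, hl, z, hz, rfl⟩ := key x
    obtain ⟨l', hl', z', hz', rfl⟩ := key y
    rw [commutatorElement_mul_center_left _ _ (hcen hz),
      commutatorElement_mul_center_right _ _ (hcen hz'), commutatorElement_def]
    exact L.mul_mem (L.mul_mem (L.mul_mem hl hl') (L.inv_mem hl)) (L.inv_mem hl')
  refine eq_top_iff.2 fun x _ => ?_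
  obtain ⟨l, hl, z, hz, rfl⟩ := key x
  exact L.mul_mem hl (hker hz)

/-- Configuration pairs lift along a surjection with central kernel contained in the
commutator subgroup. -/
theorem exists_configT_eq_of_central_surjective (π : H →* G) (hπ : Function.Surjective π)
    (hcen : π.ker ≤ Subgroup.center H) (hcom : π.ker ≤ commutator H)
    (n m : ℕ) (g : Fin n → G) (c : G → Fin m) (hg : Generates g) :
    ∃ (h : Fin n → H) (d : H → Fin m), Generates h ∧ ConfigT g c = ConfigT h d := by
  choose h hh using fun i => hπ (g i)
  have hgh : π ∘ h = g := funext hh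
  refine ⟨h, c ∘ π, eq_top_of_map_eq_top π hcen hcom _ ?_, ?_⟩
  · rw [MonoidHom.map_closure, ← Set.range_comp, hgh]
    exact hg
  · rw [configT_comp_of_surjective π hπ, hgh]

end Lifting

open LaurentPolynomial in
/-- Hall's group of matrices `(1 a c; 0 Tᵏ b; 0 0 1)` over `ℤ[T;T⁻¹]`, with the central
coordinate `c` taken modulo `N`. -/
@[ext]
structure HallGroup (N : AddSubgroup ℤ[T;T⁻¹]) where
  a : ℤ[T;T⁻¹]
  k : ℤ
  b : ℤ[T;T⁻¹]
  c : ℤ[T;T⁻¹] ⧸ N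

namespace HallGroup

noncomputable section

open LaurentPolynomial commutatorElement

variable {N N' : AddSubgroup ℤ[T;T⁻¹]}

instance : Mul (HallGroup N) :=
  ⟨fun x y => ⟨y.a + x.a * T y.k, x.k + y.k, x.b + T x.k * y.b,
    x.c + y.c + QuotientAddGroup.mk' N (x.a * y.b)⟩⟩

instance : One (HallGroup N) := ⟨⟨0, 0, 0, 0⟩⟩

instance : Inv (HallGroup N) :=
  ⟨fun x => ⟨-(x.a * T (-x.k)), -x.k, -(T (-x.k) * x.b),
    -x.c + QuotientAddGroup.mk' N (x.a * (T (-x.k) * x.b))⟩⟩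

@[simp] theorem mul_a (x y : HallGroup N) : (x * y).a = y.a + x.a * T y.k := rfl
@[simp] theorem mul_k (x y : HallGroup N) : (x * y).k = x.k + y.k := rfl
@[simp] theorem mul_b (x y : HallGroup N) : (x * y).b = x.b + T x.k * y.b := rfl
@[simp] theorem mul_c (x y : HallGroup N) :
    (x * y).c = x.c + y.c + QuotientAddGroup.mk' N (x.a * y.b) := rfl
@[simp] theorem one_a : (1 : HallGroup N).a = 0 := rfl
@[simp] theorem one_k : (1 : HallGroup N).k = 0 := rfl
@[simp] theorem one_b : (1 : HallGroup N).b = 0 := rfl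
@[simp] theorem one_c : (1 : HallGroup N).c = 0 := rfl
@[simp] theorem inv_a (x : HallGroup N) : (x⁻¹).a = -(x.a * T (-x.k)) := rfl
@[simp] theorem inv_k (x : HallGroup N) : (x⁻¹).k = -x.k := rfl
@[simp] theorem inv_b (x : HallGroup N) : (x⁻¹).b = -(T (-x.k) * x.b) := rfl
@[simp] theorem inv_c (x : HallGroup N) :
    (x⁻¹).c = -x.c + QuotientAddGroup.mk' N (x.a * (T (-x.k) * x.b)) := rfl

instance : Group (HallGroup N) :=
  Group.ofLeftAxioms
    (fun x y z => by
      ext1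
      · simp only [mul_a, mul_k, T_add]; ring
      · simp only [mul_k]; ring
      · simp only [mul_b, mul_k, T_add]; ring
      · simp only [mul_c, mul_a, mul_b, mul_add, add_mul, map_add, mul_assoc]; abel)
    (fun x => by ext1 <;> simp)
    (fun x => by
      have h : (T (-x.k) * T x.k : ℤ[T;T⁻¹]) = 1 := by rw [← T_add]; simp
      ext1
      · simp [mul_assoc, h]
      · simp
      · simp
      · simp [mul_assoc])

/-- Multiplying the coordinate `a` by `u` induces a homomorphism as soon as `u * N ≤ N'`. -/
def mapHom (u : ℤ[T;T⁻¹]) (hu : N ≤ N'.comap (AddMonoidHom.mulLeft u)) :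
    HallGroup N →* HallGroup N' where
  toFun x := ⟨u * x.a, x.k, x.b, QuotientAddGroup.map N N' (AddMonoidHom.mulLeft u) hu x.c⟩
  map_one' := by ext1 <;> simp
  map_mul' x y := by
    ext1
    · simp only [mul_a]; ring
    · simp
    · simp
    · simp [mul_assoc]

theorem mapHom_surjective {u : ℤ[T;T⁻¹]} (hu : N ≤ N'.comap (AddMonoidHom.mulLeft u))
    (hunit : IsUnit u) : Function.Surjective (mapHom u hu) := by
  rintro ⟨a, k, b, c⟩
  obtain ⟨v, hv⟩ := hunit.exists_right_inv
  obtain ⟨r, rfl⟩ := QuotientAddGroup.mk_surjective c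
  refine ⟨⟨v * a, k, b, QuotientAddGroup.mk (v * r)⟩, ?_⟩
  ext1 <;> simp [mapHom, ← mul_assoc, hv]

theorem mem_ker_mapHom {u : ℤ[T;T⁻¹]} (hu : N ≤ N'.comap (AddMonoidHom.mulLeft u))
    (hunit : IsUnit u) {x : HallGroup N} (hx : x ∈ (mapHom u hu).ker) :
    x.a = 0 ∧ x.k = 0 ∧ x.b = 0 := by
  rw [MonoidHom.mem_ker, HallGroup.ext_iff] at hx
  obtain ⟨ha, hk, hb, -⟩ := hx
  exact ⟨hunit.mul_right_eq_zero.1 ha, hk, hb⟩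

theorem mem_center {x : HallGroup N} (ha : x.a = 0) (hk : x.k = 0) (hb : x.b = 0) :
    x ∈ Subgroup.center (HallGroup N) := by
  refine Subgroup.mem_center_iff.2 fun y => ?_
  ext1 <;> simp [ha, hk, hb, add_comm]

theorem mk_eq_commutatorElement (r s : ℤ[T;T⁻¹]) :
    (⟨0, 0, 0, QuotientAddGroup.mk (r * s)⟩ : HallGroup N) =
      ⁅(⟨r, 0, 0, 0⟩ : HallGroup N), (⟨0, 0, s, 0⟩ : HallGroup N)⁆ := by
  rw [commutatorElement_def, eq_mul_inv_iff_mul_eq, eq_mul_inv_iff_mul_eq]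
  ext1 <;> simp

theorem mem_commutator {x : HallGroup N} (ha : x.a = 0) (hk : x.k = 0) (hb : x.b = 0) :
    x ∈ commutator (HallGroup N) := by
  obtain ⟨a, k, b, c⟩ := x
  obtain ⟨r, rfl⟩ := QuotientAddGroup.mk_surjective c
  simp only at ha hk hb
  subst ha hk hb
  have h := mk_eq_commutatorElement (N := N) r 1
  rw [mul_one] at h
  rw [h]
  exact Subgroup.commutator_mem_commutator (Subgroup.mem_top _) (Subgroup.mem_top _)

theorem exists_configT_eq {u : ℤ[T;T⁻¹]} (hu : N ≤ N'.comap (AddMonoidHom.mulLeft u))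
    (hunit : IsUnit u) (n m : ℕ) (g : Fin n → HallGroup N') (c : HallGroup N' → Fin m)
    (hg : Generates g) :
    ∃ (h : Fin n → HallGroup N) (d : HallGroup N → Fin m),
      Generates h ∧ ConfigT g c = ConfigT h d :=
  exists_configT_eq_of_central_surjective (mapHom u hu) (mapHom_surjective hu hunit)
    (fun _ hx => have h := mem_ker_mapHom hu hunit hx; mem_center h.1 h.2.1 h.2.2)
    (fun _ hx => have h := mem_ker_mapHom hu hunit hx; mem_commutator h.1 h.2.1 h.2.2)
    n m g c hg

theorem mem_of_forall_T_mem (L : AddSubgroup ℤ[T;T⁻¹]) (h : ∀ i, T i ∈ L) (p : ℤ[T;T⁻¹]) :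
    p ∈ L := by
  induction p using LaurentPolynomial.induction_on' with
  | add p q hp hq => exact L.add_mem hp hq
  | C_mul_T i z =>
    have : (C z * T i : ℤ[T;T⁻¹]) = z • T i := by simp
    rw [this]
    exact L.zsmul_mem (h i) z

/-- The powers of the stable letter. -/
def tPow (k : ℤ) : HallGroup N := ⟨0, k, 0, 0⟩

theorem tPow_zpow (k : ℤ) : (tPow 1 : HallGroup N) ^ k = tPow k := by
  let f : Multiplicative ℤ →* HallGroup N :=
    { toFun := fun k => tPow k.toAdd
      map_one' := rfl
      map_mul' := fun x y => by ext1 <;> simp [tPow] }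
  have h := map_zpow f (Multiplicative.ofAdd 1) k
  rw [← ofAdd_zsmul] at h
  rw [smul_eq_mul, mul_one] at h
  exact h.symm

/-- The upper left one-parameter subgroup. -/
def aHom : Multiplicative ℤ[T;T⁻¹] →* HallGroup N where
  toFun p := ⟨p.toAdd, 0, 0, 0⟩
  map_one' := rfl
  map_mul' x y := by ext1 <;> simp [add_comm]

/-- The lower right one-parameter subgroup. -/
def bHom : Multiplicative ℤ[T;T⁻¹] →* HallGroup N where
  toFun p := ⟨0, 0, p.toAdd, 0⟩
  map_one' := rfl
  map_mul' x y := by ext1 <;> simp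

theorem fg : Group.FG (HallGroup N) := by
  refine Group.fg_iff.2 ⟨{tPow 1, ⟨1, 0, 0, 0⟩, ⟨0, 0, 1, 0⟩}, ?_, by simp⟩
  set L := Subgroup.closure ({tPow 1, ⟨1, 0, 0, 0⟩, ⟨0, 0, 1, 0⟩} : Set (HallGroup N))
  have ht : ∀ k, tPow k ∈ L := fun k => by
    rw [← tPow_zpow]
    exact L.zpow_mem (Subgroup.subset_closure (by simp)) k
  have ha : ∀ p, (⟨p, 0, 0, 0⟩ : HallGroup N) ∈ L := by
    refine mem_of_forall_T_mem (L.comap aHom).toAddSubgroup' fun i => ?_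
    have h : (⟨T i, 0, 0, 0⟩ : HallGroup N) = tPow (-i) * ⟨1, 0, 0, 0⟩ * tPow i := by
      ext1 <;> simp [tPow]
    change (⟨T i, 0, 0, 0⟩ : HallGroup N) ∈ L
    rw [h]
    exact L.mul_mem (L.mul_mem (ht _) (Subgroup.subset_closure (by simp))) (ht _)
  have hb : ∀ p, (⟨0, 0, p, 0⟩ : HallGroup N) ∈ L := by
    refine mem_of_forall_T_mem (L.comap bHom).toAddSubgroup' fun i => ?_
    have h : (⟨0, 0, T i, 0⟩ : HallGroup N) = tPow i * ⟨0, 0, 1, 0⟩ * tPow (-i) := by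
      ext1 <;> simp [tPow]
    change (⟨0, 0, T i, 0⟩ : HallGroup N) ∈ L
    rw [h]
    exact L.mul_mem (L.mul_mem (ht _) (Subgroup.subset_closure (by simp))) (ht _)
  have hc : ∀ p : ℤ[T;T⁻¹], (⟨0, 0, 0, QuotientAddGroup.mk p⟩ : HallGroup N) ∈ L := fun p => by
    have h := mk_eq_commutatorElement (N := N) p 1
    rw [mul_one] at h
    rw [h, commutatorElement_def]
    exact L.mul_mem (L.mul_mem (L.mul_mem (ha _) (hb _)) (L.inv_mem (ha _))) (L.inv_mem (hb _))
  refine eq_top_iff.2 fun x _ => ?_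
  obtain ⟨a, k, b, c⟩ := x
  obtain ⟨r, rfl⟩ := QuotientAddGroup.mk_surjective c
  have h : (⟨a, k, b, QuotientAddGroup.mk r⟩ : HallGroup N) =
      ⟨0, 0, 0, QuotientAddGroup.mk r⟩ * ⟨0, 0, b, 0⟩ * tPow k * ⟨a, 0, 0, 0⟩ := by
    ext1 <;> simp [tPow]
  rw [h]
  exact L.mul_mem (L.mul_mem (L.mul_mem (hc _) (hb _)) (ht _)) (ha _)

theorem isSolvable : Group.IsSolvable (HallGroup N) := by
  have h1 : ∀ x ∈ derivedSeries (HallGroup N) 1, x.k = 0 := by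
    let f : HallGroup N →* Multiplicative ℤ :=
      { toFun := fun x => Multiplicative.ofAdd x.k
        map_one' := rfl
        map_mul' := fun x y => rfl }
    have : derivedSeries (HallGroup N) 1 ≤ f.ker := by
      rw [derivedSeries_succ]
      refine Subgroup.commutator_le.2 fun x _ y _ => ?_
      rw [MonoidHom.mem_ker, map_commutatorElement, commutatorElement_eq_one_iff_mul_comm, mul_comm]
    exact fun x hx => Multiplicative.ofAdd.injective (this hx)
  have h2 : derivedSeries (HallGroup N) 2 ≤ Subgroup.center (HallGroup N) := by
    rw [derivedSeries_succ]
    refine Subgroup.commutator_le.2 fun x hx y hy => ?_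
    have hxk := h1 x hx
    have hyk := h1 y hy
    rw [commutatorElement_def]
    apply mem_center <;> simp [hxk, hyk]
  refine ⟨3, ?_⟩
  rw [derivedSeries_succ, eq_bot_iff]
  refine Subgroup.commutator_le.2 fun x _ y hy => ?_
  rw [Subgroup.mem_bot, commutatorElement_eq_one_iff_mul_comm]
  exact Subgroup.mem_center_iff.1 (h2 hy) x

/-- Laurent polynomials with only negative exponents. -/
def negPart : AddSubgroup ℤ[T;T⁻¹] where
  carrier := {p | ∀ i : ℤ, 0 ≤ i → p.coeff i = 0}
  zero_mem' := by simp
  add_mem' hp hq i hi := by simp [hp i hi, hq i hi]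
  neg_mem' hp i hi := by simp [hp i hi]

/-- Laurent polynomials with only negative exponents and even coefficient of `T⁻¹`. -/
def evenNegPart : AddSubgroup ℤ[T;T⁻¹] where
  carrier := {p | (∀ i : ℤ, 0 ≤ i → p.coeff i = 0) ∧ 2 ∣ p.coeff (-1)}
  zero_mem' := by simp
  add_mem' hp hq := ⟨fun i hi => by simp [hp.1 i hi, hq.1 i hi], by
    simpa using dvd_add hp.2 hq.2⟩
  neg_mem' hp := ⟨fun i hi => by simp [hp.1 i hi], by
    simpa only [AddMonoidAlgebra.coeff_neg, Finsupp.neg_apply, dvd_neg] using hp.2⟩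

theorem coeff_T_mul (p : ℤ[T;T⁻¹]) (n i : ℤ) : (T n * p).coeff i = p.coeff (i - n) := by
  rw [T, AddMonoidAlgebra.coeff_single_mul_eq_mul_coeff (i - n) (fun d _ => by omega), one_mul]

theorem evenNegPart_le : evenNegPart ≤ negPart.comap (AddMonoidHom.mulLeft 1) :=
  fun p hp => by
    rw [AddSubgroup.mem_comap, AddMonoidHom.coe_mulLeft, one_mul]
    exact hp.1

theorem negPart_le : negPart ≤ evenNegPart.comap (AddMonoidHom.mulLeft (T (-1))) := by
  intro p hp
  refine ⟨fun i hi => ?_, ?_⟩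
  · exact (coeff_T_mul p (-1) i).trans (hp _ (by omega))
  · change 2 ∣ (T (-1) * p).coeff (-1)
    rw [coeff_T_mul, hp _ (by omega)]
    exact dvd_zero 2

theorem eq_one_of_mul_self_eq_one (x : HallGroup negPart) (hx : x * x = 1) : x = 1 := by
  obtain ⟨a, k, b, c⟩ := x
  obtain ⟨r, rfl⟩ := QuotientAddGroup.mk_surjective c
  rw [HallGroup.ext_iff] at hx
  obtain ⟨ha, hk, hb, hc⟩ := hx
  simp only [mul_a, mul_b, mul_c, mul_k, one_a, one_b, one_c, one_k] at ha hk hb hc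
  obtain rfl : k = 0 := by omega
  have double : ∀ p : ℤ[T;T⁻¹], p + p = 0 → p = 0 := fun p hp => by
    ext i
    have := congrArg (fun q => q.coeff i) hp
    simp at this ⊢
    omega
  obtain rfl := double a (by simpa using ha)
  obtain rfl := double b (by simpa using hb)
  have hr : r + r ∈ negPart := by
    rw [← QuotientAddGroup.eq_zero_iff]
    simpa using hc
  have hr' : r ∈ negPart := fun i hi => by
    have := hr i hi
    simp at this
    omega
  ext1
  · rfl
  · rfl
  · rfl
  · exact (QuotientAddGroup.eq_zero_iff r).2 hr'

theorem exists_mul_self_eq_one : ∃ x : HallGroup evenNegPart, x * x = 1 ∧ x ≠ 1 := by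
  refine ⟨⟨0, 0, 0, QuotientAddGroup.mk (T (-1))⟩, ?_, fun h => ?_⟩
  · ext1
    · simp
    · simp
    · simp
    · simp only [mul_c, mul_zero, map_zero, add_zero, one_c]
      rw [← QuotientAddGroup.mk_add, QuotientAddGroup.eq_zero_iff]
      refine ⟨fun i hi => ?_, ?_⟩
      · have : ¬ (-1 = i) := by omega
        simp [this]
      · simp
  · have h' := ((QuotientAddGroup.eq_zero_iff _).1 (congrArg HallGroup.c h)).2
    simp at h'

theorem isEmpty_mulEquiv : IsEmpty (HallGroup negPart ≃* HallGroup evenNegPart) := by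
  refine ⟨fun e => ?_⟩
  obtain ⟨x, hx, hx1⟩ := exists_mul_self_eq_one
  have h : e.symm x = 1 :=
    eq_one_of_mul_self_eq_one _ (by rw [← map_mul, hx, map_one])
  exact hx1 (by simpa using h)

end

end HallGroup

theorem stmt15 : ∃ (G H : Type) (instG : Group G) (instH : Group H),
    letI := instG; letI := instH;
    Group.FG G ∧ Group.FG H ∧ IsSolvable G ∧ IsSolvable H ∧
    ConfigTEquiv G H ∧ IsEmpty (G ≃* H) := by
  refine ⟨HallGroup HallGroup.negPart, HallGroup HallGroup.evenNegPart, inferInstance,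
    inferInstance, HallGroup.fg, HallGroup.fg, HallGroup.isSolvable, HallGroup.isSolvable,
    ⟨?_, ?_⟩, HallGroup.isEmpty_mulEquiv⟩
  · exact HallGroup.exists_configT_eq HallGroup.evenNegPart_le isUnit_one
  · exact HallGroup.exists_configT_eq HallGroup.negPart_le (LaurentPolynomial.isUnit_T (-1))
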